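/- Let B be a compact Hausdorff space, O a nonempty compact topological space, and V a finite-dimensional linear subspace of C(B,ℝ) containing the constant function 1. Suppose that for each x ∈ O a linear functional ℓ_x : V → ℝ is given with ℓ_x(1) = 1, and that for every Φ ∈ V the map x ↦ ℓ_x(Φ) is continuous on O. Then there exist a finite regular positive Borel measure τ on B and, for each x ∈ O, a regular Borel probability measure ρ_x on B, such that ℓ_x(Φ) + ∫_B Φ dτ = (1 + τ(B)) · ∫_B Φ dρ_x for all Φ ∈ V and all x ∈ O. -/

import Mathlib

open MeasureTheory

lemma innerRegular_dirac_aux {B : Type*} [TopologicalSpace B] [MeasurableSpace B] (b : B) :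
    (Measure.dirac b).InnerRegular := by
  refine ⟨fun U hU r hr => ?_⟩
  by_cases hb : b ∈ U
  · refine ⟨{b}, by simpa using hb, isCompact_singleton, hr.trans_le ?_⟩
    rw [Measure.dirac_apply_of_mem (Set.mem_singleton b)]
    exact prob_le_one
  · rw [Measure.dirac_apply' _ hU] at hr
    simp [hb] at hr

/-- A finite positive combination of point masses. -/
lemma exists_pointMass_measure {B : Type*} [TopologicalSpace B] [CompactSpace B] [T2Space B]
    [MeasurableSpace B] [BorelSpace B] {ι : Type*} [Fintype ι] (p : ι → B) (w : ι → ℝ)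
    (hw : ∀ i, 0 ≤ w i) :
    ∃ μ : Measure B, IsFiniteMeasure μ ∧ μ.Regular ∧ (μ Set.univ).toReal = ∑ i, w i ∧
      ∀ f : C(B, ℝ), ∫ b, f b ∂μ = ∑ i, w i * f (p i) := by
  have hd : ∀ b : B, (Measure.dirac b).InnerRegular := innerRegular_dirac_aux
  let μ : Measure B := ∑ i, ENNReal.ofReal (w i) • Measure.dirac (p i)
  have huniv : μ Set.univ = ∑ i, ENNReal.ofReal (w i) := by
    simp [μ, Measure.finsetSum_apply]
  have hfin : IsFiniteMeasure μ := by
    constructor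
    rw [huniv]
    exact ENNReal.sum_lt_top.2 fun i _ => ENNReal.ofReal_lt_top
  have hir : μ.InnerRegular := by
    dsimp only [μ]; infer_instance
  refine ⟨μ, hfin, inferInstance, ?_, fun f => ?_⟩
  · rw [huniv, ENNReal.toReal_sum (fun i _ => ENNReal.ofReal_ne_top)]
    exact Finset.sum_congr rfl fun i _ => ENNReal.toReal_ofReal (hw i)
  · dsimp only [μ]
    rw [integral_finsetSum_measure]
    · refine Finset.sum_congr rfl fun i _ => ?_
      rw [integral_smul_measure, integral_dirac, ENNReal.toReal_ofReal (hw i), smul_eq_mul]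
    · intro i _
      exact (integrable_dirac (by simp)).smul_measure ENNReal.ofReal_ne_top

/-- Interpolation points for a finite-dimensional space of continuous functions. -/
lemma exists_interpolation {B : Type*} [TopologicalSpace B] [CompactSpace B]
    (V : Subspace ℝ C(B, ℝ)) [FiniteDimensional ℝ V] :
    ∃ (s : Set (Module.Dual ℝ V)) (_ : Fintype s) (p : s → B) (e : s → V),
      ∀ (l : Module.Dual ℝ V) (Φ : V), l Φ = ∑ i, l (e i) * (Φ : C(B, ℝ)) (p i) := by
  let ev : B → Module.Dual ℝ V := fun b =>
    { toFun := fun Φ => (Φ : C(B, ℝ)) b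
      map_add' := fun _ _ => rfl
      map_smul' := fun _ _ => rfl }
  have hspan : Submodule.span ℝ (Set.range ev) = ⊤ := by
    by_contra h
    obtain ⟨f, hf, hle⟩ := Submodule.exists_le_ker_of_lt_top _ (lt_top_iff_ne_top.2 h)
    obtain ⟨Φ, rfl⟩ := (Module.evalEquiv ℝ V).surjective f
    apply hf
    have : Φ = 0 := by
      ext b
      exact hle (Submodule.subset_span ⟨b, rfl⟩)
    rw [this, map_zero]
  obtain ⟨s, hs, hsp, hli⟩ := exists_linearIndependent ℝ (Set.range ev)
  let bas : Module.Basis s ℝ (Module.Dual ℝ V) := Module.Basis.mk hli (by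
    rw [Subtype.range_coe, hsp, hspan])
  have hft : Fintype s := FiniteDimensional.fintypeBasisIndex bas
  choose p hp using fun i : s => hs i.2
  refine ⟨s, hft, p, fun i => (Module.evalEquiv ℝ V).symm (bas.coord i), fun l Φ => ?_⟩
  conv_lhs => rw [← bas.sum_repr l]
  rw [LinearMap.sum_apply]
  refine Finset.sum_congr rfl fun i _ => ?_
  have h1 : l ((Module.evalEquiv ℝ V).symm (bas.coord i)) = bas.repr l i := by
    rw [Module.apply_evalEquiv_symm_apply, Module.Basis.coord_apply]
  have h2 : bas i Φ = (Φ : C(B, ℝ)) (p i) := by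
    rw [Module.Basis.mk_apply, ← hp i]; rfl
  rw [h1, LinearMap.smul_apply, h2, smul_eq_mul]


open MeasureTheory

/-- For a compact Hausdorff space `B`, a nonempty compact space `O`, a
finite-dimensional subspace `V` of `C(B,ℝ)` containing the constant `1`, and a
family of linear functionals `ℓ x : V → ℝ` (`x ∈ O`) with `ℓ x 1 = 1` that is
pointwise continuous in `x`, there exist a finite regular positive Borel
measure `τ` on `B` and regular Borel probability measures `ρ x` on `B` such
that `ℓ x Φ + ∫ Φ dτ = (1 + τ(B)) ∫ Φ d(ρ x)` for all `Φ ∈ V` and `x ∈ O`. -/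
theorem exists_perturbing_measure_and_LTE_measures
    (B : Type*) [TopologicalSpace B] [CompactSpace B] [T2Space B]
    [MeasurableSpace B] [BorelSpace B]
    (O : Type*) [TopologicalSpace O] [CompactSpace O] [Nonempty O]
    (V : Subspace ℝ C(B, ℝ)) [FiniteDimensional ℝ V]
    (h1 : (1 : C(B, ℝ)) ∈ V)
    (ℓ : O → V →ₗ[ℝ] ℝ)
    (hℓ1 : ∀ x : O, ℓ x ⟨(1 : C(B, ℝ)), h1⟩ = 1)
    (hcont : ∀ Φ : V, Continuous fun x : O => ℓ x Φ) :
    ∃ τ : Measure B, IsFiniteMeasure τ ∧ τ.Regular ∧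
      ∃ ρ : O → Measure B,
        (∀ x, IsProbabilityMeasure (ρ x)) ∧ (∀ x, (ρ x).Regular) ∧
        ∀ (x : O) (Φ : V),
          ℓ x Φ + ∫ b, (Φ : C(B, ℝ)) b ∂τ
            = (1 + (τ Set.univ).toReal) * ∫ b, (Φ : C(B, ℝ)) b ∂(ρ x) := by
  obtain ⟨s, hft, p, e, he⟩ := exists_interpolation V
  have hb : ∀ i : s, ∃ C : ℝ, ∀ x : O, ‖ℓ x (e i)‖ ≤ C := fun i => by
    obtain ⟨C, hC⟩ := isCompact_univ.exists_bound_of_continuousOn (hcont (e i)).continuousOn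
    exact ⟨C, fun x => hC x (Set.mem_univ x)⟩
  choose C hC using hb
  have hC0 : ∀ i, 0 ≤ C i := fun i => (norm_nonneg _).trans (hC i (Classical.arbitrary O))
  obtain ⟨τ, hτf, hτr, hτu, hτi⟩ := exists_pointMass_measure p C hC0
  have hN : 0 < 1 + ∑ i, C i := by
    have := Finset.sum_nonneg fun i (_ : i ∈ Finset.univ) => hC0 i
    linarith
  have hw : ∀ x i, 0 ≤ (ℓ x (e i) + C i) / (1 + ∑ j, C j) := fun x i => by
    have := (abs_le.1 (hC i x)).1
    exact div_nonneg (by linarith) hN.le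
  choose ρ hρf hρr hρu hρi using fun x => exists_pointMass_measure p _ (hw x)
  refine ⟨τ, hτf, hτr, ρ, fun x => ⟨?_⟩, hρr, fun x Φ => ?_⟩
  · have hone : ∑ i, ℓ x (e i) = 1 := by
      rw [← hℓ1 x, he (ℓ x)]
      simp
    have h := hρu x
    rw [← Finset.sum_div, Finset.sum_add_distrib, hone, div_self hN.ne'] at h
    exact (ENNReal.toReal_eq_one_iff _).1 h
  · rw [hτi, hτu, hρi, he (ℓ x) Φ, ← Finset.sum_add_distrib, Finset.mul_sum]
    refine Finset.sum_congr rfl fun i _ => ?_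
    field_simp
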